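/- arXiv:1806.06035 — 4 statements merged into one kernel-verified Lean document; each statement's English description precedes it below -/
import Mathlib

section
/- Let C ⊆ ℝⁿ be a nonempty closed convex set, let H be a symmetric positive-definite n×n real matrix whose smallest eigenvalue is at least λ > 0, and let h, h' ∈ ℝⁿ with ‖h − h'‖₂ ≤ 1. Let z* be the unique minimizer of z ↦ ½⟨z, Hz⟩ + ⟨h, z⟩ over C and let z'* be the unique minimizer of z ↦ ½⟨z, Hz⟩ + ⟨h', z⟩ over C. Then ‖z* − z'*‖₂ ≤ 1/λ. -/
open scoped RealInnerProductSpace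

/-- First-order optimality condition for a quadratic function minimized over a convex set. -/
theorem inner_nonneg_of_isMinOn_quadratic {E : Type*} [NormedAddCommGroup E]
    [InnerProductSpace ℝ E] {T : E →ₗ[ℝ] E} (hT : T.IsSymmetric) {C : Set E}
    (hC : Convex ℝ C) {h z w : E} (hz : z ∈ C) (hw : w ∈ C)
    (hmin : ∀ y ∈ C, (1/2) * ⟪z, T z⟫ + ⟪h, z⟫ ≤ (1/2) * ⟪y, T y⟫ + ⟪h, y⟫) :
    0 ≤ ⟪T z + h, w - z⟫ := by
  have key : ∀ t : ℝ, 0 < t → t ≤ 1 →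
      0 ≤ ⟪T z + h, w - z⟫ + t * (⟪w - z, T (w - z)⟫ / 2) := by
    intro t ht ht1
    have hle := hmin _ (hC.add_smul_sub_mem hz hw ⟨ht.le, ht1⟩)
    generalize w - z = d at hle ⊢
    have hsymm : ⟪z, T d⟫ = ⟪T z, d⟫ := (hT z d).symm
    have hcomm : ⟪d, T z⟫ = ⟪T z, d⟫ := real_inner_comm _ _
    simp only [map_add, map_smul, inner_add_left, inner_add_right, real_inner_smul_left,
      real_inner_smul_right, hsymm, hcomm] at hle ⊢
    refine nonneg_of_mul_nonneg_right (a := t) ?_ ht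
    linarith
  by_contra! hneg
  set a := ⟪T z + h, w - z⟫
  set q := ⟪w - z, T (w - z)⟫ / 2
  have hden : 0 < |q| - a := by linarith [abs_nonneg q]
  have hk := key (-a / (2 * (|q| - a))) (by apply div_pos <;> linarith)
    (by rw [div_le_one (by linarith)]; linarith [abs_nonneg q])
  have hb : -a / (2 * (|q| - a)) * q ≤ -a / 2 := by
    rw [div_mul_eq_mul_div, div_le_div_iff₀ (by linarith) two_pos]
    nlinarith [le_abs_self q]
  linarith

/-- A lower bound on the eigenvalues of a Hermitian matrix bounds its quadratic form below. -/
theorem Matrix.IsHermitian.mul_norm_sq_le_inner {n : Type*} [Fintype n] [DecidableEq n]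
    {H : Matrix n n ℝ} (hH : H.IsHermitian) {c : ℝ} (hc : ∀ i, c ≤ hH.eigenvalues i)
    (x : EuclideanSpace ℝ n) : c * ‖x‖ ^ 2 ≤ ⟪x, Matrix.toEuclideanLin H x⟫ := by
  have hT := Matrix.isSymmetric_toEuclideanLin_iff.2 hH
  have heig : ∀ i, Matrix.toEuclideanLin H (hH.eigenvectorBasis i) =
      hH.eigenvalues i • hH.eigenvectorBasis i := by
    intro i
    apply (WithLp.ofLp_injective 2)
    simpa [Matrix.ofLp_toLpLin] using hH.mulVec_eigenvectorBasis i
  rw [← real_inner_self_eq_norm_sq, ← hH.eigenvectorBasis.sum_inner_mul_inner x x,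
    ← hH.eigenvectorBasis.sum_inner_mul_inner x, Finset.mul_sum]
  refine Finset.sum_le_sum fun i _ => ?_
  rw [← hT, heig, real_inner_smul_left, real_inner_comm x]
  nlinarith [mul_le_mul_of_nonneg_right (hc i) (mul_self_nonneg ⟪x, hH.eigenvectorBasis i⟫)]

/-- **Sensitivity bound for protecting `h`.**
For a nonempty closed convex set `C ⊆ ℝⁿ`, a symmetric positive definite matrix `H` whose
smallest eigenvalue is at least `lam > 0`, and linear terms `h, h'` with `‖h - h'‖ ≤ 1`,
the minimizers of `z ↦ ½⟨z, Hz⟩ + ⟨h, z⟩` and of `z ↦ ½⟨z, Hz⟩ + ⟨h', z⟩` over `C`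
are at distance at most `1 / lam`. -/
theorem stmt0 {n : ℕ} (C : Set (EuclideanSpace ℝ (Fin n)))
    (hCne : C.Nonempty) (hCcl : IsClosed C) (hCcv : Convex ℝ C)
    (H : Matrix (Fin n) (Fin n) ℝ) (hH : H.PosDef)
    (lam : ℝ) (hlam : 0 < lam) (heig : ∀ i, lam ≤ hH.1.eigenvalues i)
    (h h' : EuclideanSpace ℝ (Fin n)) (hdist : ‖h - h'‖ ≤ 1)
    (zs zs' : EuclideanSpace ℝ (Fin n)) (hzsC : zs ∈ C) (hzs'C : zs' ∈ C)
    (hzs : ∀ z ∈ C, (1/2) * ⟪zs, Matrix.toEuclideanLin H zs⟫ + ⟪h, zs⟫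
      ≤ (1/2) * ⟪z, Matrix.toEuclideanLin H z⟫ + ⟪h, z⟫)
    (hzs' : ∀ z ∈ C, (1/2) * ⟪zs', Matrix.toEuclideanLin H zs'⟫ + ⟪h', zs'⟫
      ≤ (1/2) * ⟪z, Matrix.toEuclideanLin H z⟫ + ⟪h', z⟫) :
    ‖zs - zs'‖ ≤ 1 / lam := by
  have hT := Matrix.isSymmetric_toEuclideanLin_iff.2 hH.1
  have h1 := inner_nonneg_of_isMinOn_quadratic hT hCcv hzsC hzs'C hzs
  have h2 := inner_nonneg_of_isMinOn_quadratic hT hCcv hzs'C hzsC hzs'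
  have hlow := hH.1.mul_norm_sq_le_inner heig (zs - zs')
  have hcs : ⟪h' - h, zs - zs'⟫ ≤ ‖zs - zs'‖ := by
    refine (real_inner_le_norm _ _).trans (mul_le_of_le_one_left (norm_nonneg _) ?_)
    rwa [norm_sub_rev]
  have hsum : ⟪zs - zs', Matrix.toEuclideanLin H (zs - zs')⟫ ≤ ⟪h' - h, zs - zs'⟫ := by
    rw [real_inner_comm]
    simp only [map_sub, inner_sub_left, inner_sub_right, inner_add_left] at h1 h2 ⊢
    linarith
  rw [le_div_iff₀ hlam]
  rcases (norm_nonneg (zs - zs')).eq_or_lt with h0 | hpos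
  · simp [← h0]
  · refine le_of_mul_le_mul_right ?_ hpos
    linarith
end

section
/- Let C ⊆ ℝⁿ be a nonempty closed convex set, let H be a symmetric positive-definite n×n real matrix whose smallest eigenvalue is at least λ > 0, and let h, h' ∈ ℝⁿ. Let z* be the unique minimizer of z ↦ ½⟨z, Hz⟩ + ⟨h, z⟩ over C and let z'* be the unique minimizer of z ↦ ½⟨z, Hz⟩ + ⟨h', z⟩ over C. Then ‖z* − z'*‖₂ ≤ ‖h − h'‖₂ / λ. -/
open scoped RealInnerProductSpace

/-- First-order optimality condition for a quadratic function on a convex set. -/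
theorem inner_gradient_nonneg_of_quadratic_min {E : Type*} [NormedAddCommGroup E]
    [InnerProductSpace ℝ E] {T : E →ₗ[ℝ] E} (hT : T.IsSymmetric) {C : Set E}
    (hC : Convex ℝ C) {h x : E} (hx : x ∈ C)
    (hmin : ∀ z ∈ C, (1/2) * ⟪x, T x⟫ + ⟪h, x⟫ ≤ (1/2) * ⟪z, T z⟫ + ⟪h, z⟫)
    {z : E} (hz : z ∈ C) : 0 ≤ ⟪T x + h, z - x⟫ := by
  obtain ⟨d, rfl⟩ : ∃ d, z = x + d := ⟨z - x, by abel⟩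
  rw [add_sub_cancel_left]
  by_contra! ha
  set a := ⟪T x + h, d⟫ with ha_def
  set b := ⟪d, T d⟫ with hb_def
  have key : ∀ t : ℝ, 0 < t → t ≤ 1 → 0 ≤ a + t * b / 2 := by
    intro t ht ht1
    have hm := hmin _ (hC.add_smul_mem hx hz ⟨ht.le, ht1⟩)
    have hs : ⟪x, T d⟫ = ⟪T x, d⟫ := (hT x d).symm
    have hs' : ⟪d, T x⟫ = ⟪T x, d⟫ := real_inner_comm _ _
    simp only [map_add, map_smul, inner_add_left, inner_add_right, real_inner_smul_left,
      real_inner_smul_right, hs, hs'] at hm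
    rw [inner_add_left] at ha_def
    refine nonneg_of_mul_nonneg_right (a := t) ?_ ht
    rw [ha_def]
    nlinarith
  have hb : 0 < |b| + 1 := by positivity
  have ht : 0 < min 1 (-a / (|b| + 1)) := lt_min one_pos (div_pos (neg_pos.2 ha) hb)
  have hk := key _ ht (min_le_left _ _)
  have hle : min 1 (-a / (|b| + 1)) * (|b| + 1) ≤ -a :=
    (le_div_iff₀ hb).1 (min_le_right _ _)
  nlinarith [mul_le_mul_of_nonneg_left (le_abs_self b) ht.le]

/-- A lower bound on the eigenvalues bounds the quadratic form from below. -/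
theorem Matrix.IsHermitian.mul_norm_sq_le_inner_toEuclideanLin {ι : Type*} [Fintype ι]
    [DecidableEq ι] {H : Matrix ι ι ℝ} (hH : H.IsHermitian) {c : ℝ}
    (hc : ∀ i, c ≤ hH.eigenvalues i) (x : EuclideanSpace ℝ ι) :
    c * ‖x‖ ^ 2 ≤ ⟪x, Matrix.toEuclideanLin H x⟫ := by
  have hT : (Matrix.toEuclideanLin H).IsSymmetric := Matrix.isSymmetric_toEuclideanLin_iff.2 hH
  have hb : ∀ i, Matrix.toEuclideanLin H (hH.eigenvectorBasis i) =
      hH.eigenvalues i • hH.eigenvectorBasis i := fun i => by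
    ext j
    exact congrFun (hH.mulVec_eigenvectorBasis i) j
  rw [← real_inner_self_eq_norm_sq, ← hH.eigenvectorBasis.sum_inner_mul_inner x x,
    ← hH.eigenvectorBasis.sum_inner_mul_inner x (Matrix.toEuclideanLin H x), Finset.mul_sum]
  refine Finset.sum_le_sum fun i _ => ?_
  rw [← hT, hb, real_inner_smul_left, real_inner_comm]
  nlinarith [mul_le_mul_of_nonneg_right (hc i) (mul_self_nonneg ⟪hH.eigenvectorBasis i, x⟫)]

/-- **Un-normalized perturbation bound for protecting `h`.**
If `H` is symmetric positive definite with smallest eigenvalue at least `lam > 0`, then the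
minimizers over a nonempty closed convex set `C` of `z ↦ ½⟨z, Hz⟩ + ⟨h, z⟩` and
`z ↦ ½⟨z, Hz⟩ + ⟨h', z⟩` satisfy `‖z* - z'*‖ ≤ ‖h - h'‖ / lam`. -/
theorem stmt1 {n : ℕ} (C : Set (EuclideanSpace ℝ (Fin n)))
    (hCne : C.Nonempty) (hCcl : IsClosed C) (hCcv : Convex ℝ C)
    (H : Matrix (Fin n) (Fin n) ℝ) (hH : H.PosDef)
    (lam : ℝ) (hlam : 0 < lam) (heig : ∀ i, lam ≤ hH.1.eigenvalues i)
    (h h' : EuclideanSpace ℝ (Fin n))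
    (zs zs' : EuclideanSpace ℝ (Fin n)) (hzsC : zs ∈ C) (hzs'C : zs' ∈ C)
    (hzs : ∀ z ∈ C, (1/2) * ⟪zs, Matrix.toEuclideanLin H zs⟫ + ⟪h, zs⟫
      ≤ (1/2) * ⟪z, Matrix.toEuclideanLin H z⟫ + ⟪h, z⟫)
    (hzs' : ∀ z ∈ C, (1/2) * ⟪zs', Matrix.toEuclideanLin H zs'⟫ + ⟪h', zs'⟫
      ≤ (1/2) * ⟪z, Matrix.toEuclideanLin H z⟫ + ⟪h', z⟫) :
    ‖zs - zs'‖ ≤ ‖h - h'‖ / lam := by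
  have hT : (Matrix.toEuclideanLin H).IsSymmetric := Matrix.isSymmetric_toEuclideanLin_iff.2 hH.1
  have h₁ := inner_gradient_nonneg_of_quadratic_min hT hCcv hzsC hzs hzs'C
  have h₂ := inner_gradient_nonneg_of_quadratic_min hT hCcv hzs'C hzs' hzsC
  have hq := hH.1.mul_norm_sq_le_inner_toEuclideanLin heig (zs - zs')
  have hcs := real_inner_le_norm (h' - h) (zs - zs')
  have hsum : ⟪zs - zs', Matrix.toEuclideanLin H (zs - zs')⟫ ≤ ⟪h' - h, zs - zs'⟫ := by
    rw [real_inner_comm, map_sub]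
    simp only [inner_add_left, inner_sub_left, inner_sub_right] at h₁ h₂ ⊢
    linarith
  rw [norm_sub_rev h' h] at hcs
  rw [le_div_iff₀ hlam]
  rcases (norm_nonneg (zs - zs')).eq_or_lt with h0 | h0
  · rw [← h0, zero_mul]
    exact norm_nonneg _
  · refine le_of_mul_le_mul_right ?_ h0
    linarith
end

section
/- Let C ⊆ ℝⁿ be a nonempty closed convex set, let h ∈ ℝⁿ, and let H, H' be symmetric positive-definite n×n real matrices. Let z* be the unique minimizer of z ↦ ½⟨z, Hz⟩ + ⟨h, z⟩ over C and let z'* be the unique minimizer of z ↦ ½⟨z, H'z⟩ + ⟨h, z⟩ over C, and set Δ = z* − z'*. Then ⟨Δ, H'Δ⟩ ≤ ⟨Δ, (H' − H)z*⟩. -/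
open scoped RealInnerProductSpace

/-- First-order optimality condition for a quadratic function over a convex set. -/
theorem LinearMap.IsSymmetric.variational_inequality_of_isMinOn
    {E : Type*} [NormedAddCommGroup E] [InnerProductSpace ℝ E]
    {T : E →ₗ[ℝ] E} (hT : T.IsSymmetric) {C : Set E} (hC : Convex ℝ C) {h x y : E}
    (hx : x ∈ C) (hy : y ∈ C)
    (hmin : ∀ z ∈ C, (1/2) * ⟪x, T x⟫ + ⟪h, x⟫ ≤ (1/2) * ⟪z, T z⟫ + ⟪h, z⟫) :
    0 ≤ ⟪y - x, T x⟫ + ⟪h, y - x⟫ := by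
  set d := y - x with hd
  have key : ∀ t : ℝ, 0 < t → t ≤ 1 →
      0 ≤ (⟪d, T x⟫ + ⟪h, d⟫) + t * ((1/2) * ⟪d, T d⟫) := by
    intro t ht ht1
    have hz := hmin _ (hC.add_smul_sub_mem hx hy ⟨ht.le, ht1⟩)
    rw [← hd] at hz
    have hsymm : ⟪x, T d⟫ = ⟪d, T x⟫ := by
      rw [← hT x d, real_inner_comm]
    simp only [map_add, map_smul, inner_add_left, inner_add_right, real_inner_smul_left,
      real_inner_smul_right, hsymm] at hz
    refine nonneg_of_mul_nonneg_right ?_ ht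
    linarith
  have hlim : Filter.Tendsto
      (fun t : ℝ => (⟪d, T x⟫ + ⟪h, d⟫) + t * ((1/2) * ⟪d, T d⟫))
      (nhdsWithin 0 (Set.Ioi 0)) (nhds (⟪d, T x⟫ + ⟪h, d⟫)) := by
    refine Filter.Tendsto.mono_left ?_ nhdsWithin_le_nhds
    refine Continuous.tendsto' (by fun_prop) _ _ (by simp)
  refine ge_of_tendsto hlim ?_
  filter_upwards [Ioc_mem_nhdsGT (zero_lt_one (α := ℝ))] with t ht
  exact key t ht.1 ht.2

/-- **Key intermediate inequality for the `H`-sensitivity bound.**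
If `z*` minimizes `z ↦ ½⟨z, Hz⟩ + ⟨h, z⟩` over the nonempty closed convex set `C` and
`z'*` minimizes `z ↦ ½⟨z, H'z⟩ + ⟨h, z⟩` over `C`, then with `Δ = z* - z'*` one has
`⟨Δ, H'Δ⟩ ≤ ⟨Δ, (H' - H)z*⟩`. -/
theorem stmt3 {n : ℕ} (C : Set (EuclideanSpace ℝ (Fin n)))
    (hCne : C.Nonempty) (hCcl : IsClosed C) (hCcv : Convex ℝ C)
    (h : EuclideanSpace ℝ (Fin n))
    (H H' : Matrix (Fin n) (Fin n) ℝ) (hH : H.PosDef) (hH' : H'.PosDef)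
    (zs zs' : EuclideanSpace ℝ (Fin n)) (hzsC : zs ∈ C) (hzs'C : zs' ∈ C)
    (hzs : ∀ z ∈ C, (1/2) * ⟪zs, Matrix.toEuclideanLin H zs⟫ + ⟪h, zs⟫
      ≤ (1/2) * ⟪z, Matrix.toEuclideanLin H z⟫ + ⟪h, z⟫)
    (hzs' : ∀ z ∈ C, (1/2) * ⟪zs', Matrix.toEuclideanLin H' zs'⟫ + ⟪h, zs'⟫
      ≤ (1/2) * ⟪z, Matrix.toEuclideanLin H' z⟫ + ⟪h, z⟫) :
    ⟪zs - zs', Matrix.toEuclideanLin H' (zs - zs')⟫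
      ≤ ⟪zs - zs', Matrix.toEuclideanLin (H' - H) zs⟫ := by
  have hsymm := Matrix.isSymmetric_toEuclideanLin_iff.mpr hH.isHermitian
  have hsymm' := Matrix.isSymmetric_toEuclideanLin_iff.mpr hH'.isHermitian
  have h₁ := hsymm.variational_inequality_of_isMinOn hCcv hzsC hzs'C hzs
  have h₂ := hsymm'.variational_inequality_of_isMinOn hCcv hzs'C hzsC hzs'
  simp only [map_sub, LinearMap.sub_apply, inner_sub_left, inner_sub_right] at h₁ h₂ ⊢
  linarith
end

section
/- Let H be a real Hilbert space, let C ⊆ H be a nonempty closed convex set, and let φ : H → ℝ be differentiable and ρ-strongly convex on C with ρ > 0. Let w* ∈ C be the minimizer of φ over C. Then for every w ∈ C, every e ∈ H, and every τ > 0, the point w⁺ = proj_C(w − τ(∇φ(w) + e)) satisfies ‖w⁺ − w*‖² ≤ (1 − 2ρτ)‖w − w*‖² − 2τ⟨e, w − w*⟩ + τ²‖∇φ(w) + e‖². -/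
open scoped RealInnerProductSpace

/-- The first-order lower bound for a convex function differentiable at a point. -/
theorem ConvexOn.add_fderiv_sub_le {E : Type*} [NormedAddCommGroup E] [NormedSpace ℝ E]
    {s : Set E} {f : E → ℝ} {f' : E →L[ℝ] ℝ} {x y : E} (hf : ConvexOn ℝ s f)
    (hx : x ∈ s) (hy : y ∈ s) (hf' : HasFDerivAt f f' x) :
    f x + f' (y - x) ≤ f y := by
  have hline : HasDerivAt (f ∘ AffineMap.lineMap (k := ℝ) x y) (f' (y - x)) 0 := by
    refine HasFDerivAt.comp_hasDerivAt 0 ?_ AffineMap.hasDerivAt_lineMap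
    simpa using hf'
  have hconv := hf.comp_affineMap (AffineMap.lineMap (k := ℝ) x y)
  have h := hconv.le_slope_of_hasDerivAt (x := 0) (y := 1) (by simpa using hx)
    (by simpa using hy) one_pos hline
  simp only [slope_def_field, Function.comp_apply, AffineMap.lineMap_apply_zero,
    AffineMap.lineMap_apply_one, sub_zero, div_one] at h
  linarith

/-- The quadratic lower bound for a strongly convex function differentiable at a point. -/
theorem add_inner_sub_add_sq_le_of_stronglyConvex {H : Type*} [NormedAddCommGroup H]
    [InnerProductSpace ℝ H] {C : Set H} {φ : H → ℝ} {ρ : ℝ} {a x y : H}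
    (hsc : ConvexOn ℝ C (fun x => φ x - ρ / 2 * ‖x‖ ^ 2))
    (hx : x ∈ C) (hy : y ∈ C) (ha : HasFDerivAt φ (innerSL ℝ a) x) :
    φ x + ⟪a, y - x⟫ + ρ / 2 * ‖y - x‖ ^ 2 ≤ φ y := by
  have h := hsc.add_fderiv_sub_le hx hy
    (ha.sub ((hasStrictFDerivAt_norm_sq x).hasFDerivAt.const_mul (ρ / 2)))
  simp [inner_sub_right] at h
  rw [norm_sub_sq_real, inner_sub_right, real_inner_comm x y]
  linarith

/-- The variational inequality at a minimizer over a convex set. -/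
theorem inner_sub_nonneg_of_isMinOn {H : Type*} [NormedAddCommGroup H]
    [InnerProductSpace ℝ H] {C : Set H} {φ : H → ℝ} {a x y : H} (hC : Convex ℝ C)
    (hmin : IsMinOn φ C x) (hx : x ∈ C) (hy : y ∈ C)
    (ha : HasFDerivAt φ (innerSL ℝ a) x) : 0 ≤ ⟪a, y - x⟫ :=
  hmin.localize.hasFDerivWithinAt_nonneg ha.hasFDerivWithinAt
    (sub_mem_posTangentConeAt_of_segment_subset (hC.segment_subset hx hy))

/-- A closest point of a convex set is no farther from points of the set than the
projected point is. -/
theorem norm_sub_le_of_forall_norm_sub_le {H : Type*} [NormedAddCommGroup H]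
    [InnerProductSpace ℝ H] {C : Set H} {p y z : H} (hC : Convex ℝ C)
    (hp : p ∈ C) (hproj : ∀ u ∈ C, ‖p - y‖ ≤ ‖u - y‖) (hz : z ∈ C) :
    ‖p - z‖ ≤ ‖y - z‖ := by
  have hd : HasFDerivAt (fun u => ‖u - y‖ ^ 2) (innerSL ℝ ((2 : ℝ) • (p - y))) p := by
    refine ((hasFDerivAt_id p).sub_const y).norm_sq.congr_fderiv ?_
    ext v
    simp
  have h := inner_sub_nonneg_of_isMinOn hC
    (isMinOn_iff.2 fun u hu => pow_le_pow_left₀ (norm_nonneg _) (hproj u hu) 2) hp hz hd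
  rw [real_inner_smul_left] at h
  have hyz : y - z = (p - z) - (p - y) := by abel
  have hcomm : ⟪p - z, p - y⟫ = -⟪p - y, z - p⟫ := by
    rw [real_inner_comm, ← inner_neg_right, neg_sub]
  refine le_of_sq_le_sq ?_ (norm_nonneg _)
  rw [hyz, norm_sub_sq_real (p - z) (p - y), hcomm]
  nlinarith [sq_nonneg ‖p - y‖]

/-- **Single-step contraction of the projected (stochastic) gradient step.**
Let `C` be a nonempty closed convex subset of a real Hilbert space, `φ` differentiable on
`C` (gradient `g`) and `ρ`-strongly convex on `C` (`ρ > 0`), with minimizer `w*` of `φ`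
over `C`. For `w ∈ C`, an error `e`, a step `τ > 0`, the projection
`w⁺ = proj_C (w - τ(∇φ(w) + e))` (characterized as the closest point of `C`) satisfies
`‖w⁺ - w*‖² ≤ (1 - 2ρτ)‖w - w*‖² - 2τ⟨e, w - w*⟩ + τ²‖∇φ(w) + e‖²`. -/
theorem stmt12 {H : Type*} [NormedAddCommGroup H] [InnerProductSpace ℝ H]
    [CompleteSpace H]
    (C : Set H) (hCne : C.Nonempty) (hCcl : IsClosed C) (hCcv : Convex ℝ C)
    (φ : H → ℝ) (ρ : ℝ) (hρ : 0 < ρ)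
    (hsc : ConvexOn ℝ C (fun x => φ x - ρ / 2 * ‖x‖ ^ 2))
    (g : H → H) (hg : ∀ x ∈ C, HasFDerivAt φ (innerSL ℝ (g x)) x)
    (wstar : H) (hws : wstar ∈ C) (hmin : ∀ u ∈ C, φ wstar ≤ φ u)
    (w : H) (hw : w ∈ C) (e : H) (τ : ℝ) (hτ : 0 < τ)
    (wplus : H) (hwp : wplus ∈ C)
    (hproj : ∀ u ∈ C, ‖wplus - (w - τ • (g w + e))‖ ≤ ‖u - (w - τ • (g w + e))‖) :
    ‖wplus - wstar‖ ^ 2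
      ≤ (1 - 2 * ρ * τ) * ‖w - wstar‖ ^ 2 - 2 * τ * ⟪e, w - wstar⟫
        + τ ^ 2 * ‖g w + e‖ ^ 2 := by
  have hstrong := add_inner_sub_add_sq_le_of_stronglyConvex hsc hw hws (hg w hw)
  have hstar := add_inner_sub_add_sq_le_of_stronglyConvex hsc hws hw (hg wstar hws)
  have hvar := inner_sub_nonneg_of_isMinOn hCcv (fun u hu => hmin u hu) hws hw (hg wstar hws)
  rw [← neg_sub w wstar, inner_neg_right, norm_neg] at hstrong
  have hmono : ρ * ‖w - wstar‖ ^ 2 ≤ ⟪g w, w - wstar⟫ := by linarith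
  have hcontr := norm_sub_le_of_forall_norm_sub_le hCcv hwp hproj hws
  have hexp : ‖w - τ • (g w + e) - wstar‖ ^ 2 = ‖w - wstar‖ ^ 2
      - 2 * τ * (⟪g w, w - wstar⟫ + ⟪e, w - wstar⟫) + τ ^ 2 * ‖g w + e‖ ^ 2 := by
    rw [sub_right_comm, norm_sub_sq_real, real_inner_smul_right, real_inner_comm,
      inner_add_left, norm_smul, mul_pow, Real.norm_eq_abs, sq_abs]
    ring
  calc ‖wplus - wstar‖ ^ 2 ≤ ‖w - τ • (g w + e) - wstar‖ ^ 2 := by gcongr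
    _ ≤ _ := by
      rw [hexp]
      linarith [mul_le_mul_of_nonneg_left hmono hτ.le]
end
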